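/- arXiv:1311.1616 — 3 statements merged into one kernel-verified Lean document; each statement's English description precedes it below -/
import Mathlib

section
/- There exist constants α > 0, c₁ > 0, c₂ > 0 such that for all integers n ≥ 2 and d with 1 ≤ d ≤ c₁·n/(log₂n)⁴, setting m = ⌈α·√(n·d)⌉ and t = ⌊n/m⌋, the read-once DNF F = OR_t(AND_m,…,AND_m) : ({-1,1}^m)^t → {-1,1} satisfies W(F, d) ≥ 2^{c₂·√(n/d)}; that is, every polynomial threshold function for F of degree at most d has weight at least 2^{c₂·√(n/d)}. -/
open Finset

noncomputable section

/-- The real value of a Boolean bit: `true` encodes `-1` (logical TRUE), `false` encodes `1`. -/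
def bval (b : Bool) : ℝ := if b then -1 else 1

/-- The parity character `χ_S(x) = ∏_{i ∈ S} x_i`. -/
def chi {ι : Type*} (S : Finset ι) (x : ι → Bool) : ℝ := ∏ i ∈ S, bval (x i)

/-- The multilinear polynomial with coefficient family `c`. -/
def polyOf {ι : Type*} [Fintype ι] (c : Finset ι → ℝ) (x : ι → Bool) : ℝ :=
  ∑ S : Finset ι, c S * chi S x

/-- The AND function: TRUE (`true`, i.e. `-1`) iff all inputs are TRUE. -/
def ANDf (n : ℕ) (x : Fin n → Bool) : Bool := decide (∀ i, x i = true)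

/-- The block composition `OR_t(f, …, f)`; it is TRUE (`true`, i.e. `-1`) iff some copy of
`f` is TRUE. -/
def orBlock (t : ℕ) {ι : Type*} [Fintype ι] [DecidableEq ι]
    (f : (ι → Bool) → Bool) (x : Fin t × ι → Bool) : Bool :=
  decide (∃ i : Fin t, f (fun j => x (i, j)) = true)

lemma sum_inv_sq_le (D : ℕ) : ∑ i ∈ range D, (((i : ℝ) + 1) ^ 2)⁻¹ ≤ 2 := by
  have h := sum_Ioo_inv_sq_le (α := ℝ) 0 (D + 1)
  have e : ∑ i ∈ Ioo 0 (D + 1), ((i : ℝ) ^ 2)⁻¹ = ∑ i ∈ range D, (((i : ℝ) + 1) ^ 2)⁻¹ := by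
    have : Ioo 0 (D + 1) = Ico 1 (D + 1) := by ext; simp; omega
    rw [this, Finset.sum_Ico_eq_sum_range]
    apply Finset.sum_congr (by simp)
    intro i _
    push_cast
    rw [add_comm]
  rw [e] at h
  simpa using h

def nuw (D l : ℕ) : ℝ :=
  -((-1 : ℝ) ^ (l + D)) * ((2 * D).choose l / (2 * D).choose D) / (17 * ((l : ℝ) - D) ^ 2 - 1)

lemma nuw_self (D : ℕ) : nuw D D = 1 := by
  have h : ((2 * D).choose D : ℝ) ≠ 0 := by
    exact_mod_cast (Nat.choose_pos (by omega)).ne'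
  have h2 : (-1 : ℝ) ^ (D + D) = 1 := by rw [← two_mul, pow_mul]; simp
  unfold nuw
  rw [h2, div_self h]; norm_num

lemma one_le_sq_sub {l D : ℕ} (h : l ≠ D) : (1 : ℝ) ≤ ((l : ℝ) - D) ^ 2 := by
  have : (1 : ℤ) ≤ ((l : ℤ) - D) ^ 2 := by
    have : ((l : ℤ) - D) ≠ 0 := by omega
    have := sq_pos_of_ne_zero this
    omega
  exact_mod_cast this

lemma abs_nuw_le {l D : ℕ} (h : l ≠ D) : |nuw D l| ≤ (1 / 16) * ((((l : ℝ) - D) ^ 2)⁻¹) := by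
  have h1 := one_le_sq_sub h
  have hc : (0 : ℝ) < (2 * D).choose D := by
    exact_mod_cast (Nat.choose_pos (by omega))
  have hr : ((2 * D).choose l / (2 * D).choose D : ℝ) ≤ 1 := by
    rw [div_le_one hc]
    have := Nat.choose_le_centralBinom l D
    unfold Nat.centralBinom at this
    exact_mod_cast this
  unfold nuw
  rw [abs_div, abs_mul, abs_neg, abs_pow, abs_neg, abs_one, one_pow, one_mul,
    abs_of_nonneg (by positivity), abs_of_nonneg (by linarith)]
  rw [← one_div, div_mul_div_comm, div_le_div_iff₀ (by linarith) (by linarith)]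
  nlinarith

lemma sum_abs_nuw (D : ℕ) : ∑ l ∈ (range (2 * D + 1)).erase D, |nuw D l| ≤ 1 / 4 := by
  have h0 : ∑ l ∈ (range (2 * D + 1)).erase D, |nuw D l| ≤
      ∑ l ∈ (range (2 * D + 1)).erase D, (1 / 16) * ((((l : ℝ) - D) ^ 2)⁻¹) :=
    Finset.sum_le_sum fun l hl => abs_nuw_le (Finset.ne_of_mem_erase hl)
  refine h0.trans ?_
  rw [← Finset.mul_sum]
  have h1 : ∑ l ∈ (range (2 * D + 1)).erase D, ((((l : ℝ) - D) ^ 2)⁻¹)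
      = ∑ l ∈ range (2 * D + 1), ((((l : ℝ) - D) ^ 2)⁻¹) := by
    apply Finset.sum_erase; simp
  rw [h1, show 2 * D + 1 = D + (D + 1) by ring, Finset.sum_range_add, Finset.sum_range_succ']
  have h2 := sum_inv_sq_le D
  have h3 : ∑ l ∈ range D, ((((l : ℝ) - D) ^ 2)⁻¹) = ∑ i ∈ range D, (((i : ℝ) + 1) ^ 2)⁻¹ := by
    rw [← Finset.sum_range_reflect]
    apply Finset.sum_congr rfl
    intro i hi
    have := Finset.mem_range.1 hi
    rw [Nat.cast_sub (by omega), Nat.cast_sub (by omega)]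
    congr 1; push_cast; ring
  have h4 : ∑ k ∈ range D, ((((D + (k + 1) : ℕ) : ℝ) - D) ^ 2)⁻¹
      = ∑ i ∈ range D, (((i : ℝ) + 1) ^ 2)⁻¹ := by
    apply Finset.sum_congr rfl
    intro i hi
    congr 1; push_cast; ring
  rw [h3, h4]
  simp only [add_zero, sub_self]
  norm_num
  linarith

lemma alt_sum (n j : ℕ) (h : j < n) (a b : ℝ) (f : ℕ → ℝ)
    (hf : ∀ l, f l = (a + b * l) ^ j) :
    ∑ l ∈ range (n + 1), (-1 : ℝ) ^ l * n.choose l * f l = 0 := by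
  open Polynomial in
  have hd : ((C a + C b * X : ℝ[X]) ^ j).natDegree < n := by
    refine lt_of_le_of_lt natDegree_pow_le ?_
    have : (C a + C b * X : ℝ[X]).natDegree ≤ 1 := by
      compute_degree
    nlinarith
  have h1 := congrFun (Polynomial.fwdDiff_iter_eq_zero_of_degree_lt hd) 0
  rw [fwdDiff_iter_eq_sum_shift] at h1
  simp only [Pi.zero_apply, zsmul_eq_mul] at h1
  have h2 : ∑ l ∈ range (n + 1), (-1 : ℝ) ^ l * n.choose l * f l
      = (-1) ^ n * ∑ x ∈ range (n + 1), (((-1 : ℤ) ^ (n - x) * (n.choose x : ℤ) : ℤ) : ℝ) *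
        Polynomial.eval (0 + x • (1 : ℝ))
          ((Polynomial.C a + Polynomial.C b * Polynomial.X : Polynomial ℝ) ^ j) := by
    rw [Finset.mul_sum]
    apply Finset.sum_congr rfl
    intro l hl
    have hl' := Finset.mem_range.1 hl
    have e : (-1 : ℝ) ^ n * (-1) ^ (n - l) = (-1) ^ l := by
      rw [← pow_add, show n + (n - l) = 2 * (n - l) + l by omega, pow_add, pow_mul]; simp
    push_cast
    simp [hf]
    rw [← e]; ring
  rw [h2, h1, mul_zero]

lemma nuw_moment (D j : ℕ) (hj : j ≤ D) :
    ∑ l ∈ range (2 * D + 1), nuw D l * ((17 * ((l : ℝ) - D) ^ 2) ^ j - 1) = 0 := by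
  have key : ∀ l ∈ range (2 * D + 1), nuw D l * ((17 * ((l : ℝ) - D) ^ 2) ^ j - 1)
      = ∑ i ∈ range j, (-((-1 : ℝ) ^ D) / (2 * D).choose D * 17 ^ i) *
        ((-1 : ℝ) ^ l * (2 * D).choose l * ((-D + 1 * l : ℝ) ^ (2 * i))) := by
    intro l _
    have hne : (17 * ((l : ℝ) - D) ^ 2 - 1) ≠ 0 := by
      by_cases h : l = D
      · subst h; simp
      · have := one_le_sq_sub h
        intro h'; linarith
    rw [← geom_sum_mul, Finset.sum_mul, Finset.mul_sum]
    apply Finset.sum_congr rfl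
    intro i _
    unfold nuw
    rw [mul_pow, ← pow_mul, pow_add]
    have : (-D + 1 * l : ℝ) = l - D := by ring
    rw [this]
    field_simp
  rw [Finset.sum_congr rfl key, Finset.sum_comm]
  apply Finset.sum_eq_zero
  intro i hi
  have := Finset.mem_range.1 hi
  rw [← Finset.mul_sum, alt_sum (2 * D) (2 * i) (by omega) (-D) 1 _ (fun l => rfl), mul_zero]

lemma moment_bound (D d t k : ℕ) (hD : 1 ≤ D) (hDd : D ≤ d) (hDt : D = d ∨ D = t) (hk : k ≤ d)
    (τ : ℝ) (hτ : τ = 1 / (272 * D * d)) :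
    |∑ l ∈ range (2 * D + 1), nuw D l * ((1 - τ * (17 * ((l : ℝ) - D) ^ 2)) ^ k - (1 - τ) ^ k)|
      ≤ 5 / 4 * (1 / 4) ^ t := by
  have hD0 : (1 : ℝ) ≤ D := by exact_mod_cast hD
  have hd0 : (1 : ℝ) ≤ d := by exact_mod_cast (hD.trans hDd)
  have hτ0 : 0 < τ := by rw [hτ]; positivity
  have hexp : ∀ y : ℝ, (1 - τ * y) ^ k = ∑ j ∈ range (k + 1), k.choose j * (-τ) ^ j * y ^ j := by
    intro y
    rw [show 1 - τ * y = (-τ) * y + 1 by ring, add_pow]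
    apply Finset.sum_congr rfl
    intro j _
    rw [one_pow, mul_pow]; ring
  have h1 : ∑ l ∈ range (2 * D + 1),
      nuw D l * ((1 - τ * (17 * ((l : ℝ) - D) ^ 2)) ^ k - (1 - τ) ^ k)
      = ∑ j ∈ range (k + 1), k.choose j * (-τ) ^ j *
        ∑ l ∈ range (2 * D + 1), nuw D l * ((17 * ((l : ℝ) - D) ^ 2) ^ j - 1) := by
    have h1τ := hexp 1
    rw [mul_one] at h1τ
    simp_rw [hexp, h1τ, ← Finset.sum_sub_distrib, Finset.mul_sum]
    rw [Finset.sum_comm]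
    refine Finset.sum_congr rfl fun j _ => Finset.sum_congr rfl fun l _ => ?_
    rw [one_pow]; ring
  have hsum : ∑ l ∈ range (2 * D + 1), |nuw D l| ≤ 5 / 4 := by
    rw [← Finset.add_sum_erase _ _ (Finset.mem_range.2 (by omega : D < 2 * D + 1)), nuw_self, abs_one]
    have := sum_abs_nuw D
    linarith
  have hin : ∀ j, |∑ l ∈ range (2 * D + 1), nuw D l * ((17 * ((l : ℝ) - D) ^ 2) ^ j - 1)|
      ≤ 5 / 4 * (17 * (D : ℝ) ^ 2) ^ j := by
    intro j
    refine (Finset.abs_sum_le_sum_abs _ _).trans ?_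
    refine le_trans (Finset.sum_le_sum (g := fun l => |nuw D l| * (17 * (D : ℝ) ^ 2) ^ j) ?_) ?_
    · intro l hl
      have hl' : l ≤ 2 * D := by have := Finset.mem_range.1 hl; omega
      have hl2 : (l : ℝ) ≤ 2 * D := by exact_mod_cast hl'
      have hl0 : (0 : ℝ) ≤ l := by positivity
      rw [abs_mul]
      refine mul_le_mul_of_nonneg_left ?_ (abs_nonneg _)
      have e1 : (17 * ((l : ℝ) - D) ^ 2) ^ j ≤ (17 * (D : ℝ) ^ 2) ^ j := by
        apply pow_le_pow_left₀ (by positivity)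
        nlinarith
      have e2 : (1 : ℝ) ≤ (17 * (D : ℝ) ^ 2) ^ j := one_le_pow₀ (by nlinarith)
      have e3 : 0 ≤ (17 * ((l : ℝ) - D) ^ 2) ^ j := by positivity
      rw [abs_le]; constructor <;> linarith
    · rw [← Finset.sum_mul]
      exact mul_le_mul_of_nonneg_right hsum (by positivity)
  rw [h1]
  rcases hDt with hDt | hDt
  · rw [Finset.sum_eq_zero]
    · simp
    · intro j hj
      have := Finset.mem_range.1 hj
      rw [nuw_moment D j (by omega), mul_zero]
  · have hterm : ∀ j ∈ range (k + 1), |(k.choose j : ℝ) * (-τ) ^ j *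
        ∑ l ∈ range (2 * D + 1), nuw D l * ((17 * ((l : ℝ) - D) ^ 2) ^ j - 1)|
        ≤ 5 / 4 * (1 / 16) ^ D * ((D : ℝ) ^ j / j.factorial) := by
      intro j hj
      by_cases hjD : j ≤ D
      · rw [nuw_moment D j hjD, mul_zero, abs_zero]; positivity
      · rw [abs_mul, abs_mul, abs_pow, abs_neg, abs_of_pos hτ0, Nat.abs_cast]
        have c1 : (k.choose j : ℝ) ≤ (d : ℝ) ^ j / j.factorial := by
          refine (Nat.choose_le_pow_div (α := ℝ) j k).trans ?_
          have : (k : ℝ) ≤ d := by exact_mod_cast hk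
          gcongr
        calc (k.choose j : ℝ) * τ ^ j *
              |∑ l ∈ range (2 * D + 1), nuw D l * ((17 * ((l : ℝ) - D) ^ 2) ^ j - 1)|
            ≤ ((d : ℝ) ^ j / j.factorial) * τ ^ j * (5 / 4 * (17 * (D : ℝ) ^ 2) ^ j) := by
              gcongr
              exact hin j
          _ = 5 / 4 * (d * τ * (17 * (D : ℝ) ^ 2)) ^ j / j.factorial := by
              rw [mul_pow, mul_pow]; ring
          _ = 5 / 4 * (1 / 16) ^ j * ((D : ℝ) ^ j / j.factorial) := by
              have : d * τ * (17 * (D : ℝ) ^ 2) = (1 / 16) * D := by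
                rw [hτ]; field_simp; norm_num
              rw [this, mul_pow]; ring
          _ ≤ _ := by
              have : (1 / 16 : ℝ) ^ j ≤ (1 / 16) ^ D :=
                pow_le_pow_of_le_one (by norm_num) (by norm_num) (by omega)
              gcongr
    refine (Finset.abs_sum_le_sum_abs _ _).trans ((Finset.sum_le_sum hterm).trans ?_)
    rw [← Finset.mul_sum]
    have he := Real.sum_le_exp_of_nonneg (x := (D : ℝ)) (by positivity) (k + 1)
    have he2 : Real.exp D ≤ 4 ^ D := by
      rw [← mul_one (D : ℝ), Real.exp_nat_mul]
      have := Real.exp_one_lt_d9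
      exact pow_le_pow_left₀ (Real.exp_pos _).le (by linarith) _
    calc _ ≤ 5 / 4 * (1 / 16 : ℝ) ^ D * 4 ^ D := by
          have := he.trans he2
          gcongr
      _ = 5 / 4 * (1 / 4) ^ t := by
          rw [mul_assoc, ← mul_pow, hDt]; norm_num

def Bz {m : ℕ} (z : ℝ) (x : Fin m → Bool) : ℝ := ∏ i, (1 - z * bval (x i)) / 2

lemma chi_eq_prod {ι : Type*} [Fintype ι] [DecidableEq ι] (S : Finset ι) (x : ι → Bool) :
    chi S x = ∏ i, if i ∈ S then bval (x i) else 1 := by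
  unfold chi
  rw [Finset.prod_ite_mem, Finset.univ_inter]

lemma Bz_chi {m : ℕ} (z : ℝ) (S : Finset (Fin m)) :
    ∑ x : Fin m → Bool, Bz z x * chi S x = (-z) ^ S.card := by
  simp_rw [chi_eq_prod, Bz, ← Finset.prod_mul_distrib]
  rw [← Fintype.prod_sum (fun i b => (1 - z * bval b) / 2 * (if i ∈ S then bval b else 1))]
  rw [Finset.prod_congr rfl (g := fun i => if i ∈ S then (-z) else 1)]
  · rw [Finset.prod_ite_mem, Finset.univ_inter, Finset.prod_const]
  · intro i _
    simp only [Fintype.sum_bool, bval]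
    split_ifs <;> simp at * <;> ring

lemma Bz_sum {m : ℕ} (z : ℝ) : ∑ x : Fin m → Bool, Bz z x = 1 := by
  have := Bz_chi (m := m) z ∅
  simpa [chi] using this

lemma Bz_nonneg {m : ℕ} {z : ℝ} (h0 : 0 ≤ z) (h1 : z ≤ 1) (x : Fin m → Bool) : 0 ≤ Bz z x := by
  apply Finset.prod_nonneg
  intro i _
  unfold bval
  split_ifs <;> linarith

lemma Bz_top {m : ℕ} (z : ℝ) : Bz z (fun _ : Fin m => true) = ((1 + z) / 2) ^ m := by
  simp [Bz, bval, div_pow]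

lemma Bz_one {m : ℕ} {x : Fin m → Bool} (h : x ≠ fun _ => true) : Bz 1 x = 0 := by
  obtain ⟨i, hi⟩ := Function.ne_iff.1 h
  apply Finset.prod_eq_zero (Finset.mem_univ i)
  simp at hi
  simp [hi, bval]

lemma key_dist (m d t : ℕ) (hd : 1 ≤ d) (ht : 1 ≤ t) (hm : 4352 * (t * d) ≤ m) :
    ∃ P N : (Fin m → Bool) → ℝ, (∀ x, 0 ≤ P x) ∧ (∀ x, 0 ≤ N x) ∧
      ∑ x, P x = 1 ∧ ∑ x, N x = 1 ∧ N (fun _ => true) = 0 ∧ 1 / 2 ≤ P (fun _ => true) ∧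
      ∀ S : Finset (Fin m), S.card ≤ d →
        |∑ x, P x * chi S x - ∑ x, N x * chi S x| ≤ 2 * (1 / 4) ^ t := by
  obtain ⟨D, hD1, hDd, hDt, hDtd⟩ : ∃ D : ℕ, 1 ≤ D ∧ D ≤ d ∧ D ≤ t ∧ (D = d ∨ D = t) := by
    refine ⟨min d t, by omega, by omega, by omega, by omega⟩
  obtain ⟨τ, hτ⟩ : ∃ τ : ℝ, τ = 1 / (272 * D * d) := ⟨_, rfl⟩
  have hD0 : (1 : ℝ) ≤ D := by exact_mod_cast hD1
  have hd0 : (1 : ℝ) ≤ d := by exact_mod_cast hd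
  have ht0 : (1 : ℝ) ≤ t := by exact_mod_cast ht
  have hDd' : (D : ℝ) ≤ d := by exact_mod_cast hDd
  have hDt' : (D : ℝ) ≤ t := by exact_mod_cast hDt
  have hm' : 4352 * ((t : ℝ) * d) ≤ m := by exact_mod_cast hm
  have hτ0 : 0 < τ := by rw [hτ]; positivity
  have hτD : τ * (17 * (D : ℝ) ^ 2) ≤ 1 := by
    rw [hτ, one_div_mul_eq_div, div_le_one (by positivity)]
    nlinarith
  have hτ1 : τ ≤ 1 := by nlinarith
  have hmτ : 16 ≤ m * τ := by
    rw [hτ, mul_one_div, le_div_iff₀ (by positivity)]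
    have : (D : ℝ) * d ≤ t * d := by gcongr
    nlinarith
  let y : ℕ → ℝ := fun l => 17 * ((l : ℝ) - D) ^ 2
  have hyD : y D = 0 := by simp [y]
  have hy0 : ∀ l, 0 ≤ y l := fun l => by positivity
  have hy1 : ∀ l, l ≠ D → 1 ≤ y l := fun l hl => by
    have := one_le_sq_sub hl
    simp only [y]; linarith
  have hyτ : ∀ l ∈ range (2 * D + 1), τ * y l ≤ 1 := by
    intro l hl
    have hl' : l ≤ 2 * D := by have := Finset.mem_range.1 hl; omega
    have hl2 : (l : ℝ) ≤ 2 * D := by exact_mod_cast hl'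
    have hl0 : (0 : ℝ) ≤ l := by positivity
    refine le_trans (mul_le_mul_of_nonneg_left ?_ hτ0.le) hτD
    simp only [y]; nlinarith
  -- small probability of the all-true point
  have hρ : ∀ u : ℝ, 1 ≤ u → τ * u ≤ 1 → Bz (1 - τ * u) (fun _ : Fin m => true) ≤ 1 / 8 := by
    intro u hu hu1
    rw [Bz_top]
    have h1 : (1 + (1 - τ * u)) / 2 ≤ Real.exp (-(τ / 2)) := by
      have := Real.add_one_le_exp (-(τ / 2))
      nlinarith
    have h2 : ((1 + (1 - τ * u)) / 2) ^ m ≤ Real.exp (-(τ / 2)) ^ m :=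
      pow_le_pow_left₀ (by linarith) h1 m
    refine h2.trans ?_
    rw [← Real.exp_nat_mul]
    have h3 : Real.exp (m * -(τ / 2)) ≤ Real.exp (-8) := Real.exp_le_exp.2 (by linarith)
    refine h3.trans ?_
    rw [Real.exp_neg, one_div]
    apply inv_anti₀ (by norm_num)
    have := Real.add_one_le_exp (8 : ℝ)
    linarith
  have hBn : ∀ u : ℝ, 0 ≤ u → τ * u ≤ 1 → ∀ x : Fin m → Bool, 0 ≤ Bz (1 - τ * u) x := by
    intro u hu hu1 x
    exact Bz_nonneg (by linarith) (by nlinarith) x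
  let ψ : (Fin m → Bool) → ℝ := fun x =>
    ∑ l ∈ range (2 * D + 1), nuw D l * (Bz (1 - τ * y l) x - Bz (1 - τ * 1) x)
  have hDmem : D ∈ range (2 * D + 1) := Finset.mem_range.2 (by omega)
  have hs := sum_abs_nuw D
  set R := (range (2 * D + 1)).erase D with hR
  have hψ : ∀ x, ψ x = (Bz 1 x - Bz (1 - τ * 1) x) +
      ∑ l ∈ R, nuw D l * (Bz (1 - τ * y l) x - Bz (1 - τ * 1) x) := by
    intro x
    simp only [ψ]
    rw [← Finset.add_sum_erase _ _ hDmem, nuw_self, hyD]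
    simp [hR]
  have hψchi : ∀ S : Finset (Fin m), S.card ≤ d → |∑ x, ψ x * chi S x| ≤ 5 / 4 * (1 / 4) ^ t := by
    intro S hS
    have e : ∑ x, ψ x * chi S x = (-1) ^ S.card * ∑ l ∈ range (2 * D + 1),
        nuw D l * ((1 - τ * (17 * ((l : ℝ) - D) ^ 2)) ^ S.card - (1 - τ) ^ S.card) := by
      simp only [ψ, Finset.sum_mul]
      rw [Finset.sum_comm, Finset.mul_sum]
      apply Finset.sum_congr rfl
      intro l _
      have : ∀ x : Fin m → Bool, nuw D l * (Bz (1 - τ * y l) x - Bz (1 - τ * 1) x) * chi S x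
          = nuw D l * (Bz (1 - τ * y l) x * chi S x - Bz (1 - τ * 1) x * chi S x) := by
        intro x; ring
      simp_rw [this]
      rw [← Finset.mul_sum, Finset.sum_sub_distrib, Bz_chi, Bz_chi, neg_pow, neg_pow (1 - τ * 1)]
      simp only [y, mul_one]; ring
    rw [e, abs_mul, abs_pow, abs_neg, abs_one, one_pow, one_mul]
    exact moment_bound D d t _ hD1 hDd hDtd hS τ hτ
  have hψ0 : ∑ x, ψ x = 0 := by
    simp only [ψ]
    rw [Finset.sum_comm]
    apply Finset.sum_eq_zero
    intro l _
    rw [← Finset.mul_sum, Finset.sum_sub_distrib, Bz_sum, Bz_sum]; simp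
  set top : Fin m → Bool := fun _ => true with htop
  have hψtop : 27 / 32 ≤ ψ top := by
    rw [hψ]
    have h1 : Bz 1 top = 1 := by rw [htop, Bz_top]; norm_num
    have h2 := hρ 1 le_rfl (by linarith)
    have h20 := hBn 1 (by norm_num) (by linarith) top
    have h3 : |∑ l ∈ R, nuw D l * (Bz (1 - τ * y l) top - Bz (1 - τ * 1) top)| ≤ 1 / 4 * (1 / 8) := by
      refine (Finset.abs_sum_le_sum_abs _ _).trans ?_
      refine le_trans (Finset.sum_le_sum (g := fun l => |nuw D l| * (1 / 8)) ?_) ?_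
      · intro l hl
        have hlD := Finset.ne_of_mem_erase hl
        have hlm := Finset.mem_of_mem_erase hl
        rw [abs_mul]
        refine mul_le_mul_of_nonneg_left ?_ (abs_nonneg _)
        have h4 := hρ (y l) (hy1 l hlD) (hyτ l hlm)
        have h5 := hBn (y l) (hy0 l) (hyτ l hlm) top
        rw [abs_le]; constructor <;> linarith
      · rw [← Finset.sum_mul]; gcongr
    have := (abs_le.1 h3).1
    rw [h1]; linarith
  have hψrest : ∀ x, x ≠ top → max (ψ x) 0 ≤ ∑ l ∈ R, |nuw D l| * Bz (1 - τ * y l) x := by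
    intro x hx
    have hb : ∀ l ∈ R, 0 ≤ Bz (1 - τ * y l) x := fun l hl =>
      hBn (y l) (hy0 l) (hyτ l (Finset.mem_of_mem_erase hl)) x
    apply max_le
    · rw [hψ, Bz_one hx]
      have h20 := hBn 1 (by norm_num) (by linarith) x
      have h1 : ∑ l ∈ R, nuw D l * (Bz (1 - τ * y l) x - Bz (1 - τ * 1) x)
          ≤ ∑ l ∈ R, (|nuw D l| * Bz (1 - τ * y l) x + |nuw D l| * Bz (1 - τ * 1) x) := by
        apply Finset.sum_le_sum
        intro l hl
        have a1 := mul_le_mul_of_nonneg_right (le_abs_self (nuw D l)) (hb l hl)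
        have a2 := mul_le_mul_of_nonneg_right (neg_le_abs (nuw D l)) h20
        linarith
      rw [Finset.sum_add_distrib, ← Finset.sum_mul (f := fun l => |nuw D l|)] at h1
      nlinarith
    · exact Finset.sum_nonneg fun l hl => mul_nonneg (abs_nonneg _) (hb l hl)
  obtain ⟨M, hM⟩ : ∃ M, M = ∑ x, max (ψ x) 0 := ⟨_, rfl⟩
  have hMsplit : M = ψ top + ∑ x ∈ univ.erase top, max (ψ x) 0 := by
    rw [hM, ← Finset.add_sum_erase _ _ (Finset.mem_univ top), max_eq_left (by linarith)]
  have hrest0 : 0 ≤ ∑ x ∈ univ.erase top, max (ψ x) 0 :=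
    Finset.sum_nonneg fun x _ => le_max_right _ _
  have hrest : ∑ x ∈ univ.erase top, max (ψ x) 0 ≤ 1 / 4 := by
    calc ∑ x ∈ univ.erase top, max (ψ x) 0
        ≤ ∑ x ∈ univ.erase top, ∑ l ∈ R, |nuw D l| * Bz (1 - τ * y l) x :=
          Finset.sum_le_sum fun x hx => hψrest x (Finset.ne_of_mem_erase hx)
      _ ≤ ∑ x, ∑ l ∈ R, |nuw D l| * Bz (1 - τ * y l) x := by
          apply Finset.sum_le_sum_of_subset_of_nonneg (Finset.erase_subset _ _)
          intro x _ _
          exact Finset.sum_nonneg fun l hl => mul_nonneg (abs_nonneg _)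
            (hBn (y l) (hy0 l) (hyτ l (Finset.mem_of_mem_erase hl)) x)
      _ = ∑ l ∈ R, |nuw D l| := by
          rw [Finset.sum_comm]
          apply Finset.sum_congr rfl
          intro l _
          rw [← Finset.mul_sum, Bz_sum, mul_one]
      _ ≤ 1 / 4 := hs
  have hM0 : 27 / 32 ≤ M := by linarith
  have hMpos : 0 < M := by linarith
  have hdiff : ∀ x, max (ψ x) 0 - max (-ψ x) 0 = ψ x := fun x => max_zero_sub_max_neg_zero_eq_self _
  have hMN : ∑ x, max (-ψ x) 0 = M := by
    have : ∑ x, (max (ψ x) 0 - max (-ψ x) 0) = 0 := by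
      rw [Finset.sum_congr rfl fun x _ => hdiff x, hψ0]
    rw [Finset.sum_sub_distrib, ← hM] at this
    linarith
  refine ⟨fun x => max (ψ x) 0 / M, fun x => max (-ψ x) 0 / M, ?_, ?_, ?_, ?_, ?_, ?_, ?_⟩
  · intro x; exact div_nonneg (le_max_right _ _) hMpos.le
  · intro x; exact div_nonneg (le_max_right _ _) hMpos.le
  · rw [← Finset.sum_div, ← hM, div_self hMpos.ne']
  · rw [← Finset.sum_div, hMN, div_self hMpos.ne']
  · simp only []
    rw [max_eq_right (by linarith), zero_div]
  · simp only []
    rw [max_eq_left (by linarith), le_div_iff₀ hMpos]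
    linarith
  · intro S hS
    have e : ∑ x, max (ψ x) 0 / M * chi S x - ∑ x, max (-ψ x) 0 / M * chi S x
        = (∑ x, ψ x * chi S x) / M := by
      rw [← Finset.sum_sub_distrib, Finset.sum_div]
      apply Finset.sum_congr rfl
      intro x _
      rw [← sub_mul, ← sub_div, hdiff]; ring
    simp only []
    rw [e, abs_div, abs_of_pos hMpos, div_le_iff₀ hMpos]
    refine (hψchi S hS).trans ?_
    have : (0 : ℝ) ≤ (1 / 4) ^ t := by positivity
    nlinarith

lemma abs_prod_sub_prod_le {ι : Type*} (s : Finset ι) (a b : ι → ℝ) (ε : ℝ)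
    (ha : ∀ i, |a i| ≤ 1) (hb : ∀ i, |b i| ≤ 1) (hab : ∀ i, |a i - b i| ≤ ε) :
    |∏ i ∈ s, a i - ∏ i ∈ s, b i| ≤ s.card * ε := by
  classical
  induction s using Finset.induction_on with
  | empty => simp
  | insert i s hi ih =>
    rw [Finset.prod_insert hi, Finset.prod_insert hi, Finset.card_insert_of_notMem hi]
    have e : a i * ∏ i ∈ s, a i - b i * ∏ i ∈ s, b i
        = a i * (∏ i ∈ s, a i - ∏ i ∈ s, b i) + (a i - b i) * ∏ i ∈ s, b i := by ring
    have hB : |∏ i ∈ s, b i| ≤ 1 := by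
      rw [Finset.abs_prod]
      exact Finset.prod_le_one (fun i _ => abs_nonneg _) fun i _ => hb i
    rw [e]
    refine (abs_add_le _ _).trans ?_
    rw [abs_mul, abs_mul]
    have h1 : |a i| * |∏ i ∈ s, a i - ∏ i ∈ s, b i| ≤ 1 * (s.card * ε) :=
      mul_le_mul (ha i) ih (abs_nonneg _) (by norm_num)
    have h2 : |a i - b i| * |∏ i ∈ s, b i| ≤ ε * 1 :=
      mul_le_mul (hab i) hB (abs_nonneg _) ((abs_nonneg _).trans (hab i))
    push_cast
    linarith

lemma abs_bval (b : Bool) : |bval b| = 1 := by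
  cases b <;> simp [bval]

lemma abs_chi {ι : Type*} (S : Finset ι) (x : ι → Bool) : |chi S x| = 1 := by
  unfold chi
  rw [Finset.abs_prod]
  exact Finset.prod_eq_one fun i _ => abs_bval _

lemma chi_int {ι : Type*} (S : Finset ι) (x : ι → Bool) : ∃ k : ℤ, chi S x = k := by
  refine ⟨∏ i ∈ S, if x i then -1 else 1, ?_⟩
  unfold chi bval
  push_cast
  rfl

lemma polyOf_int {ι : Type*} [Fintype ι] (q : Finset ι → ℤ) (x : ι → Bool) :
    ∃ k : ℤ, polyOf (fun S => (q S : ℝ)) x = k := by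
  choose f hf using fun S : Finset ι => chi_int S x
  refine ⟨∑ S, q S * f S, ?_⟩
  unfold polyOf
  push_cast
  simp_rw [hf]

lemma sum_block {t m : ℕ} (f : Fin t → (Fin m → Bool) → ℝ) :
    ∑ x : Fin t × Fin m → Bool, ∏ i, f i (fun j => x (i, j)) = ∏ i, ∑ y, f i y := by
  rw [Fintype.prod_sum]
  exact Fintype.sum_equiv (Equiv.curry (Fin t) (Fin m) Bool) _ _ fun x => rfl

lemma chi_block {t m : ℕ} (S : Finset (Fin t × Fin m)) (x : Fin t × Fin m → Bool) :
    chi S x = ∏ i, chi (univ.filter fun j => (i, j) ∈ S) (fun j => x (i, j)) := by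
  simp_rw [chi_eq_prod, Fintype.prod_prod_type]
  simp

lemma sum_block_chi {t m : ℕ} (P : (Fin m → Bool) → ℝ) (S : Finset (Fin t × Fin m)) :
    ∑ x : Fin t × Fin m → Bool, (∏ i, P (fun j => x (i, j))) * chi S x
      = ∏ i, ∑ y, P y * chi (univ.filter fun j => (i, j) ∈ S) y := by
  rw [← sum_block]
  apply Finset.sum_congr rfl
  intro x _
  rw [chi_block, ← Finset.prod_mul_distrib]

lemma abs_corr_le {m : ℕ} (P : (Fin m → Bool) → ℝ) (h0 : ∀ x, 0 ≤ P x) (h1 : ∑ x, P x = 1)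
    (S : Finset (Fin m)) : |∑ y, P y * chi S y| ≤ 1 := by
  refine (Finset.abs_sum_le_sum_abs _ _).trans ?_
  rw [← h1]
  apply Finset.sum_le_sum
  intro y _
  rw [abs_mul, abs_chi, mul_one, abs_of_nonneg (h0 y)]

lemma weight_bound (m d t : ℕ) (hd : 1 ≤ d) (ht : 1 ≤ t) (hm : 4352 * (t * d) ≤ m)
    (q : Finset (Fin t × Fin m) → ℤ) (hq : ∀ S, d < S.card → q S = 0)
    (hs : ∀ x, 0 < bval (orBlock t (ANDf m) x) * polyOf (fun S => (q S : ℝ)) x) :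
    (2 : ℝ) ^ t ≤ 2 * ∑ S : Finset (Fin t × Fin m), |(q S : ℝ)| := by
  obtain ⟨P, N, hP0, hN0, hP1, hN1, hNt, hPt, hcorr⟩ := key_dist m d t hd ht hm
  set p := polyOf (fun S => (q S : ℝ)) with hp
  obtain ⟨W, hW⟩ : ∃ W, W = ∑ S : Finset (Fin t × Fin m), |(q S : ℝ)| := ⟨_, rfl⟩
  have hpW : ∀ x, |p x| ≤ W := by
    intro x
    rw [hp, hW]; unfold polyOf
    refine (Finset.abs_sum_le_sum_abs _ _).trans (le_of_eq ?_)
    apply Finset.sum_congr rfl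
    intro S _
    rw [abs_mul, abs_chi, mul_one]
  have hpos : ∀ x, orBlock t (ANDf m) x = false → 1 ≤ p x := by
    intro x hx
    obtain ⟨k, hk⟩ := polyOf_int q x
    have h := hs x
    rw [hx] at h
    simp only [bval, hp, hk] at h ⊢
    simp at h
    exact_mod_cast h
  have hneg : ∀ x, orBlock t (ANDf m) x = true → p x ≤ -1 := by
    intro x hx
    obtain ⟨k, hk⟩ := polyOf_int q x
    have h := hs x
    rw [hx] at h
    simp only [bval, hp, hk] at h ⊢
    simp at h
    have : k ≤ -1 := by omega
    exact_mod_cast this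
  have hor : ∀ x, orBlock t (ANDf m) x = true ↔ ∃ i, (fun j => x (i, j)) = fun _ => true := by
    intro x
    simp [orBlock, ANDf, funext_iff]
  -- expectation under N
  let EN : (Fin t × Fin m → Bool) → ℝ := fun x => ∏ i, N (fun j => x (i, j))
  let EP : (Fin t × Fin m → Bool) → ℝ := fun x => ∏ i, P (fun j => x (i, j))
  have hEN0 : ∀ x, 0 ≤ EN x := fun x => Finset.prod_nonneg fun i _ => hN0 _
  have hEP0 : ∀ x, 0 ≤ EP x := fun x => Finset.prod_nonneg fun i _ => hP0 _
  have hEN1 : ∑ x, EN x = 1 := by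
    simp only [EN]; rw [sum_block (fun _ => N)]; simp [hN1]
  have hEP1 : ∑ x, EP x = 1 := by
    simp only [EP]; rw [sum_block (fun _ => P)]; simp [hP1]
  have hN : 1 ≤ ∑ x, EN x * p x := by
    rw [← hEN1]
    apply Finset.sum_le_sum
    intro x _
    by_cases h : orBlock t (ANDf m) x = true
    · obtain ⟨i, hi⟩ := (hor x).1 h
      have : EN x = 0 := Finset.prod_eq_zero (Finset.mem_univ i) (by rw [hi, hNt])
      rw [this]; simp
    · have := hpos x (by simpa using h)
      nlinarith [hEN0 x]
  -- expectation under P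
  let P' : (Fin m → Bool) → ℝ := fun y => if y = (fun _ => true) then 0 else P y
  have hP'0 : ∀ y, 0 ≤ P' y := fun y => by
    simp only [P']; split_ifs; exacts [le_rfl, hP0 y]
  have hP'sum : ∑ y, P' y ≤ 1 / 2 := by
    have : ∑ y, P' y = ∑ y, P y - P (fun _ => true) := by
      rw [← Finset.add_sum_erase _ P (Finset.mem_univ (fun _ => true)),
        ← Finset.add_sum_erase _ P' (Finset.mem_univ (fun _ => true))]
      have : ∑ x ∈ univ.erase (fun _ => true), P' x = ∑ x ∈ univ.erase (fun _ => true), P x := by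
        apply Finset.sum_congr rfl
        intro y hy
        simp only [P']
        rw [if_neg (Finset.ne_of_mem_erase hy)]
      rw [this]
      simp [P']
    rw [this, hP1]; linarith
  have hW0 : 0 ≤ W := by rw [hW]; exact Finset.sum_nonneg fun _ _ => abs_nonneg _
  have hP : ∑ x, EP x * p x ≤ -1 + (W + 1) * (1 / 2) ^ t := by
    have h1 : ∀ x, EP x * p x ≤ -EP x + (W + 1) * ∏ i, P' (fun j => x (i, j)) := by
      intro x
      have hnn : 0 ≤ ∏ i, P' (fun j => x (i, j)) := Finset.prod_nonneg fun i _ => hP'0 _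
      by_cases h : orBlock t (ANDf m) x = true
      · have := hneg x h
        nlinarith [hEP0 x]
      · have e : EP x = ∏ i, P' (fun j => x (i, j)) := by
          apply Finset.prod_congr rfl
          intro i _
          simp only [P']
          rw [if_neg]
          intro hi
          exact h ((hor x).2 ⟨i, hi⟩)
        rw [← e]
        have := (abs_le.1 (hpW x)).2
        nlinarith [hEP0 x]
    refine (Finset.sum_le_sum fun x _ => h1 x).trans ?_
    rw [Finset.sum_add_distrib, Finset.sum_neg_distrib, hEP1, ← Finset.mul_sum,
      sum_block (fun _ => P')]
    simp only [Finset.prod_const, Finset.card_univ, Fintype.card_fin]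
    have := pow_le_pow_left₀ (Finset.sum_nonneg fun y _ => hP'0 y) hP'sum t
    gcongr
  -- near-indistinguishability
  have hswap : ∀ E : (Fin t × Fin m → Bool) → ℝ, ∑ x, E x * p x = ∑ S, q S * ∑ x, E x * chi S x := by
    intro E
    rw [hp]
    simp only [polyOf, Finset.mul_sum]
    rw [Finset.sum_comm]
    refine Finset.sum_congr rfl fun S _ => Finset.sum_congr rfl fun x _ => ?_
    ring
  have hdiff : |∑ x, EP x * p x - ∑ x, EN x * p x| ≤ W * (t * (2 * (1 / 4) ^ t)) := by
    rw [hswap, hswap, ← Finset.sum_sub_distrib, hW, Finset.sum_mul]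
    refine (Finset.abs_sum_le_sum_abs _ _).trans (Finset.sum_le_sum fun S _ => ?_)
    by_cases hS : d < S.card
    · rw [hq S hS]; simp
    · rw [← mul_sub, abs_mul]
      refine mul_le_mul_of_nonneg_left ?_ (abs_nonneg _)
      simp only [EP, EN]
      rw [sum_block_chi, sum_block_chi]
      have := abs_prod_sub_prod_le (univ : Finset (Fin t))
        (fun i => ∑ y, P y * chi (univ.filter fun j => (i, j) ∈ S) y)
        (fun i => ∑ y, N y * chi (univ.filter fun j => (i, j) ∈ S) y) (2 * (1 / 4) ^ t)
        (fun i => abs_corr_le P hP0 hP1 _) (fun i => abs_corr_le N hN0 hN1 _)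
        (fun i => hcorr _ ?_)
      · simpa using this
      · refine le_trans ?_ (not_lt.1 hS)
        apply Finset.card_le_card_of_injOn (fun j => (i, j))
        · intro j hj; simpa using hj
        · intro a _ b _ hab; simpa using hab
  have hW1 : 1 ≤ W := by
    have h1 := hpW (fun _ => false)
    obtain ⟨k, hk⟩ := polyOf_int q (fun _ => false)
    have h := hs (fun _ => false)
    have hk0 : k ≠ 0 := by
      rintro rfl
      rw [← hp] at hk
      rw [hk] at h; simp at h
    have : (1 : ℝ) ≤ |p (fun _ => false)| := by
      rw [hp, hk]
      exact_mod_cast Int.one_le_abs hk0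
    linarith
  have hlow := (abs_le.1 hdiff).1
  have hT : (t : ℝ) * (1 / 4) ^ t ≤ (1 / 2) ^ t := by
    have h1 : (t : ℝ) ≤ 2 ^ t := by exact_mod_cast Nat.lt_two_pow_self.le
    calc (t : ℝ) * (1 / 4) ^ t ≤ 2 ^ t * (1 / 4) ^ t := by gcongr
      _ = (1 / 2) ^ t := by rw [← mul_pow]; norm_num
  have hfin : 2 ≤ 4 * W * (1 / 2) ^ t := by
    have h2 : (0 : ℝ) < (1 / 2) ^ t := by positivity
    have h3 : W * (t * (1 / 4) ^ t) ≤ W * (1 / 2) ^ t := by gcongr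
    nlinarith
  rw [← hW]
  have h5 : (1 / 2 : ℝ) ^ t * 2 ^ t = 1 := by rw [← mul_pow]; norm_num
  have h6 : (0 : ℝ) < 2 ^ t := by positivity
  nlinarith

/-- there are constants `α, c₁, c₂ > 0` such that for all `n ≥ 2` and
`1 ≤ d ≤ c₁·n/(log₂ n)⁴`, with `m = ⌈α·√(n·d)⌉` and `t = ⌊n/m⌋`, every degree-`d`
integer polynomial threshold function for the read-once DNF `OR_t(AND_m, …, AND_m)` has
weight at least `2^{c₂·√(n/d)}`. -/
theorem read_once_dnf_threshold_weight :
    ∃ α c₁ c₂ : ℝ, 0 < α ∧ 0 < c₁ ∧ 0 < c₂ ∧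
      ∀ n d : ℕ, 2 ≤ n → 1 ≤ d → (d : ℝ) ≤ c₁ * n / (Real.logb 2 (n : ℝ)) ^ 4 →
        ∀ m t : ℕ, m = ⌈α * Real.sqrt ((n : ℝ) * d)⌉₊ → t = n / m →
          ∀ q : Finset (Fin t × Fin m) → ℤ,
            (∀ S, d < S.card → q S = 0) →
            (∀ x, 0 < bval (orBlock t (ANDf m) x) * polyOf (fun S => (q S : ℝ)) x) →
            (2 : ℝ) ^ (c₂ * Real.sqrt ((n : ℝ) / d))
              ≤ ((∑ S : Finset (Fin t × Fin m), |q S| : ℤ) : ℝ) := by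
  refine ⟨66, 1 / (64 * 66 ^ 2), 1 / (8 * 66), by norm_num, by norm_num, by norm_num, ?_⟩
  intro n d hn hd hdn m t hm ht q hq hs
  have hn0 : (2 : ℝ) ≤ n := by exact_mod_cast hn
  have hd0 : (1 : ℝ) ≤ d := by exact_mod_cast hd
  have hlog : 1 ≤ Real.logb 2 (n : ℝ) := by
    rw [Real.le_logb_iff_rpow_le (by norm_num) (by linarith)]
    simpa using hn0
  have hdn' : (d : ℝ) ≤ 1 / (64 * 66 ^ 2) * n := by
    refine hdn.trans ?_
    exact div_le_self (by positivity) (one_le_pow₀ hlog)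
  obtain ⟨r, hr⟩ : ∃ r, r = Real.sqrt ((n : ℝ) / d) := ⟨_, rfl⟩
  have hr2 : r ^ 2 = n / d := by rw [hr, Real.sq_sqrt (by positivity)]
  have hr8 : 8 * 66 ≤ r := by
    rw [hr]
    apply Real.le_sqrt_of_sq_le
    rw [le_div_iff₀ (by linarith)]
    linarith
  have hndr : (n : ℝ) = r ^ 2 * d := by rw [hr2]; field_simp
  have hsq : Real.sqrt ((n : ℝ) * d) = r * d := by
    rw [hndr, show r ^ 2 * (d : ℝ) * d = (r * d) ^ 2 by ring, Real.sqrt_sq (by positivity)]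
  rw [hsq] at hm
  have hm1 : 66 * (r * d) ≤ m := by rw [hm]; exact Nat.le_ceil _
  have hrd : 528 ≤ r * d := by nlinarith
  have hm2 : (m : ℝ) ≤ 2 * (66 * (r * d)) := by
    have := Nat.ceil_lt_add_one (a := 66 * (r * (d : ℝ))) (by positivity)
    rw [← hm] at this
    linarith
  have hmpos : (0 : ℝ) < m := by linarith
  have htm : (t : ℝ) * m ≤ n := by
    rw [ht]; exact_mod_cast Nat.div_mul_le_self n m
  have htm2 : (n : ℝ) < (t + 1) * m := by
    rw [ht]
    have := Nat.lt_div_mul_add (a := n) (b := m) (by exact_mod_cast hmpos)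
    have h2 : n < (n / m + 1) * m := by linarith
    exact_mod_cast h2
  have hr0 : 0 < r := by linarith
  have ht1 : r ≤ 132 * (t + 1) := by
    have h1 : r * (r * d) ≤ (132 * (t + 1)) * (r * d) := by
      have : (t + 1) * (m : ℝ) ≤ (t + 1) * (2 * (66 * (r * d))) := by gcongr
      nlinarith
    exact le_of_mul_le_mul_right h1 (by linarith)
  have ht3 : (3 : ℝ) ≤ t := by linarith
  have htd : 4352 * ((t : ℝ) * d) ≤ m := by
    have h1 : (66 * (r * d)) ^ 2 ≤ (m : ℝ) ^ 2 := by gcongr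
    have h2 : 4356 * (t * m * d) ≤ (m : ℝ) ^ 2 := by
      refine le_trans ?_ h1
      have : (t : ℝ) * m * d ≤ n * d := by gcongr
      rw [hndr] at this
      nlinarith
    have h3 : (4352 * ((t : ℝ) * d)) * m ≤ m * m := by
      have : 0 ≤ (t : ℝ) * m * d := by positivity
      nlinarith
    exact le_of_mul_le_mul_right h3 hmpos
  have key := weight_bound m d t hd (by
    have : (1 : ℝ) ≤ t := by linarith
    exact_mod_cast this) (by exact_mod_cast htd) q hq hs
  have h2t : (2 : ℝ) ^ (1 / (8 * 66) * r) * 2 ≤ 2 ^ t := by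
    calc (2 : ℝ) ^ (1 / (8 * 66) * r) * 2 = (2 : ℝ) ^ (1 / (8 * 66) * r + 1) := by
          rw [Real.rpow_add (by norm_num), Real.rpow_one]
      _ ≤ (2 : ℝ) ^ (t : ℝ) := by
          apply Real.rpow_le_rpow_of_exponent_le (by norm_num)
          linarith
      _ = 2 ^ t := Real.rpow_natCast _ _
  rw [← hr]
  push_cast
  linarith

end
end

section
/- There is a constant c > 0 such that for all integers d ≥ 1 and t ≥ 1, the read-once DNF F = OR_t(AND_{d²},…,AND_{d²}) : ({-1,1}^{d²})^t → {-1,1} on n = t·d² variables satisfies deg̃_{1−2^{−t}}(F) ≥ c·d; that is, every real polynomial of degree less than c·d differs from F by more than 1 − 2^{−n/d²} at some input. -/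
open Finset

noncomputable section

/-- The coefficient family `c` has degree at most `d`. -/
def degLE {ι : Type*} (c : Finset ι → ℝ) (d : ℕ) : Prop :=
  ∀ S : Finset ι, d < S.card → c S = 0

lemma amplify {X : Type*} [Fintype X] [DecidableEq X] (top : X) (Psi mu nu : X → ℝ)
    (hmu : ∀ y, 0 ≤ mu y) (hnu : ∀ y, 0 ≤ nu y) (hnt : nu top = 0) (hmt : mu top = 0)
    (hPt : Psi top ≤ 0) (hP : ∀ y, y ≠ top → Psi y = nu y - mu y)
    (hmus : ∑ y, mu y ≤ 1/4) (hnus : 1 ≤ ∑ y, nu y) :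
    ∀ (t : ℕ) (U : ℝ) (Q : (Fin t → X) → ℝ), 0 ≤ U →
      (∀ i x, ∑ y, Psi y * Q (Function.update x i y) = 0) →
      (∀ x, (∀ i, x i ≠ top) → 1 ≤ Q x) →
      (∀ x, (∃ i, x i = top) → Q x ≤ 0) → (∀ x, Q x ≤ U) → 1 ≤ U * (1/4)^t := by
  intro t
  induction t with
  | zero =>
    intro U Q _ _ h1 _ hU
    have := h1 (fun i => i.elim0) (fun i => i.elim0)
    have := hU (fun i => i.elim0)
    simp; linarith
  | succ t ih =>
    intro U Q hU0 hH h1 h0 hU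
    have key := ih (U * (1/4)) (fun x => ∑ y, mu y * Q (Fin.cons y x)) (by positivity) ?_ ?_ ?_ ?_
    · rw [pow_succ]; linarith
    · intro i x
      simp only [Finset.mul_sum]
      rw [Finset.sum_comm]
      apply Finset.sum_eq_zero
      intro z _
      have := hH i.succ (Fin.cons z x)
      simp only [← Fin.cons_update] at this
      calc _ = mu z * ∑ y, Psi y * Q (Fin.cons z (Function.update x i y)) := by
            rw [Finset.mul_sum]; apply Finset.sum_congr rfl; intros; ring
        _ = 0 := by rw [this, mul_zero]
    · intro x hx
      have h := hH 0 (Fin.cons top x)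
      simp only [Fin.update_cons_zero] at h
      have e : ∀ y, Psi y = nu y - mu y + (if y = top then Psi top else 0) := by
        intro y
        by_cases hy : y = top
        · subst hy; simp [hnt, hmt]
        · simp [hy, hP y hy]
      have h2 : ∑ y, nu y * Q (Fin.cons y x) - ∑ y, mu y * Q (Fin.cons y x)
          + Psi top * Q (Fin.cons top x) = 0 := by
        rw [← h, ← Finset.sum_sub_distrib]
        have : Psi top * Q (Fin.cons top x)
            = ∑ y, (if y = top then Psi top else 0) * Q (Fin.cons y x) := by simp
        rw [this, ← Finset.sum_add_distrib]
        apply Finset.sum_congr rfl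
        intro y _
        rw [e y, add_mul, sub_mul]
      have h3 : Q (Fin.cons top x) ≤ 0 := h0 _ ⟨0, by simp⟩
      have h4 : 0 ≤ Psi top * Q (Fin.cons top x) := mul_nonneg_of_nonpos_of_nonpos hPt h3
      have h5 : ∑ y, nu y ≤ ∑ y, nu y * Q (Fin.cons y x) := by
        apply Finset.sum_le_sum
        intro y _
        by_cases hy : y = top
        · subst hy; simp [hnt]
        · have : 1 ≤ Q (Fin.cons y x) := by
            apply h1
            intro i
            refine Fin.cases ?_ ?_ i
            · simpa using hy
            · intro j; simpa using hx j
          nlinarith [hnu y]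
      linarith
    · intro x ⟨i, hi⟩
      apply Finset.sum_nonpos
      intro y _
      exact mul_nonpos_of_nonneg_of_nonpos (hmu y) (h0 _ ⟨i.succ, by simpa using hi⟩)
    · intro x
      calc _ ≤ ∑ y, mu y * U := Finset.sum_le_sum fun y _ =>
              mul_le_mul_of_nonneg_left (hU _) (hmu y)
        _ = (∑ y, mu y) * U := by rw [Finset.sum_mul]
        _ ≤ 1/4 * U := by gcongr
        _ = _ := by ring

lemma card_supersets (m k : ℕ) (T : Finset (Fin m)) :
    (#{A ∈ powersetCard k (univ : Finset (Fin m)) | T ⊆ A} : ℕ) * m.choose #T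
      = m.choose k * k.choose #T := by
  by_cases hk : #T ≤ k
  · rw [Nat.choose_mul hk, mul_comm]
    congr 1
    have : {A ∈ powersetCard k (univ : Finset (Fin m)) | T ⊆ A}
        = (powersetCard (k - #T) Tᶜ).image (fun B => B ∪ T) := by
      ext A
      simp only [mem_filter, mem_powersetCard, subset_univ, true_and, mem_image]
      constructor
      · rintro ⟨h, hT⟩
        refine ⟨A \ T, ⟨?_, ?_⟩, ?_⟩
        · intro i; simp
        · rw [card_sdiff_of_subset hT, h]
        · exact sdiff_union_of_subset hT
      · rintro ⟨B, ⟨hB, hc⟩, rfl⟩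
        refine ⟨?_, subset_union_right⟩
        rw [card_union_of_disjoint, hc]
        · omega
        · exact disjoint_left.2 fun i hi => by simpa using hB hi
    rw [this, card_image_of_injOn, card_powersetCard, card_compl, Fintype.card_fin]
    intro B hB C hC h
    simp only [mem_coe, mem_powersetCard] at hB hC h
    have hB' : ∀ i ∈ B, i ∉ T := fun i hi => by simpa using hB.1 hi
    have hC' : ∀ i ∈ C, i ∉ T := fun i hi => by simpa using hC.1 hi
    ext i
    have := congrArg (fun s => i ∈ s) h
    simp only [mem_union, eq_iff_iff] at this
    have := hB' i; have := hC' i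
    tauto
  · have : {A ∈ powersetCard k (univ : Finset (Fin m)) | T ⊆ A} = ∅ := by
      apply filter_eq_empty_iff.2
      intro A hA h
      have := card_le_card h
      rw [(mem_powersetCard.1 hA).2] at this
      exact hk this
    rw [this, Nat.choose_eq_zero_of_lt (by omega : k < #T)]; simp

lemma sum_supersets (m s : ℕ) (ψ : ℕ → ℝ)
    (hψ : ∀ r : Polynomial ℝ, r.natDegree ≤ s → ∑ k ∈ range (m+1), ψ k * r.eval (k:ℝ) = 0)
    (T : Finset (Fin m)) (hT : #T ≤ s) :
    ∑ A : Finset (Fin m), ψ #A / m.choose #A * (if T ⊆ A then 1 else 0) = 0 := by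
  rw [← powerset_univ, sum_powerset, card_univ, Fintype.card_fin]
  have hTm : #T ≤ m := by simpa using card_le_univ T
  have hpos : (0:ℝ) < m.choose #T := by exact_mod_cast Nat.choose_pos hTm
  have h := hψ (Polynomial.C ((1:ℝ) / ((#T).factorial * m.choose #T)) * descPochhammer ℝ #T) (by
    refine (Polynomial.natDegree_C_mul_le _ _).trans ?_
    rw [descPochhammer_natDegree]; exact hT)
  refine Eq.trans ?_ h
  apply sum_congr rfl
  intro k hk
  have hkm : k ≤ m := by simpa [Nat.lt_succ_iff] using hk
  have hposk : (0:ℝ) < m.choose k := by exact_mod_cast Nat.choose_pos hkm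
  rw [Polynomial.eval_mul, Polynomial.eval_C, descPochhammer_eval_eq_descFactorial,
    Nat.descFactorial_eq_factorial_mul_choose]
  have hc := card_supersets m k T
  have hc' : (#{A ∈ powersetCard k (univ : Finset (Fin m)) | T ⊆ A} : ℝ) * m.choose #T
      = m.choose k * k.choose #T := by exact_mod_cast hc
  calc _ = ∑ A ∈ powersetCard k (univ : Finset (Fin m)),
        ψ k / m.choose k * (if T ⊆ A then (1:ℝ) else 0) := by
        apply sum_congr rfl
        intro A hA
        rw [(mem_powersetCard.1 hA).2]
    _ = ψ k / m.choose k * #{A ∈ powersetCard k (univ : Finset (Fin m)) | T ⊆ A} := by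
        rw [← mul_sum, sum_boole]
    _ = _ := by
        have hf : ((#T).factorial : ℝ) ≠ 0 := by exact_mod_cast Nat.factorial_ne_zero _
        push_cast
        field_simp
        linear_combination (ψ k) * hc'

def fal {m : ℕ} (x : Fin m → Bool) : Finset (Fin m) := univ.filter (fun i => x i = false)

lemma fal_bij (m : ℕ) : Function.Bijective (fal (m := m)) := by
  constructor
  · intro x y h
    funext i
    have := congrArg (fun s => i ∈ s) h
    simp only [fal, mem_filter, mem_univ, true_and, eq_iff_iff] at this
    cases hx : x i <;> cases hy : y i <;> simp_all
  · intro A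
    refine ⟨fun i => decide (i ∉ A), ?_⟩
    ext i; simp [fal]

lemma sum_chi (m s : ℕ) (ψ : ℕ → ℝ)
    (hψ : ∀ r : Polynomial ℝ, r.natDegree ≤ s → ∑ k ∈ range (m+1), ψ k * r.eval (k:ℝ) = 0)
    (S : Finset (Fin m)) (hS : #S ≤ s) :
    ∑ x : Fin m → Bool, ψ #(fal x) / m.choose #(fal x) * chi S x = 0 := by
  have e : ∀ x : Fin m → Bool, chi S x = ∑ T ∈ S.powerset,
      (if T ⊆ fal x then (1:ℝ) else 0) * (2 ^ #T * (-1) ^ #(S \ T)) := by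
    intro x
    have : chi S x = ∏ i ∈ S, ((if i ∈ fal x then (2:ℝ) else 0) + (-1)) := by
      unfold chi
      apply prod_congr rfl
      intro i _
      cases h : x i <;> simp [bval, fal, h]; norm_num
    rw [this, prod_add]
    apply sum_congr rfl
    intro T _
    rw [prod_const]
    by_cases h : T ⊆ fal x
    · rw [if_pos h, one_mul, prod_congr rfl (fun i hi => if_pos (h hi)), prod_const]
    · rw [if_neg h, zero_mul]
      obtain ⟨i, hi, hi'⟩ := not_subset.1 h
      rw [prod_eq_zero hi (if_neg hi'), zero_mul]
  simp only [e, mul_sum]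
  rw [sum_comm]
  apply sum_eq_zero
  intro T hT
  have h := sum_supersets m s ψ hψ T ((card_le_card (mem_powerset.1 hT)).trans hS)
  rw [← (fal_bij m).sum_comp (fun A => ψ #A / m.choose #A * (if T ⊆ A then (1:ℝ) else 0))] at h
  calc _ = (∑ x : Fin m → Bool, ψ #(fal x) / m.choose #(fal x) * (if T ⊆ fal x then (1:ℝ) else 0))
        * (2 ^ #T * (-1) ^ #(S \ T)) := by
        rw [sum_mul]; apply sum_congr rfl; intros; ring
    _ = 0 := by rw [h, zero_mul]

lemma sum_fal_card (m : ℕ) (g : ℕ → ℝ) :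
    ∑ x : Fin m → Bool, g #(fal x) / m.choose #(fal x) = ∑ k ∈ range (m+1), g k := by
  rw [(fal_bij m).sum_comp (fun A => g #A / m.choose #A), ← powerset_univ,
    sum_powerset_apply_card (fun k => g k / m.choose k)]
  simp only [card_univ, Fintype.card_fin]
  apply sum_congr rfl
  intro k hk
  have hkm : k ≤ m := by simpa [Nat.lt_succ_iff] using hk
  have hposk : (0:ℝ) < m.choose k := by exact_mod_cast Nat.choose_pos hkm
  rw [nsmul_eq_mul]; field_simp

lemma prod_low (k r : ℕ) (h : r < k) :
    (k:ℝ) * (∏ j ∈ Icc 1 r, |(k:ℝ)^2 - (j:ℝ)^2|) * (k - r - 1).factorial = (k + r).factorial := by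
  induction r with
  | zero =>
    obtain ⟨k, rfl⟩ := Nat.exists_eq_succ_of_ne_zero (by omega : k ≠ 0)
    simp [Nat.factorial_succ]
  | succ r ih =>
    have ih := ih (by omega)
    obtain ⟨l, rfl⟩ : ∃ l, k = r + 2 + l := ⟨k - (r+2), by omega⟩
    rw [prod_Icc_succ_top (by omega)]
    rw [show r + 2 + l - r - 1 = l + 1 by omega, Nat.factorial_succ] at ih
    rw [show r + 2 + l - (r+1) - 1 = l by omega,
      show r + 2 + l + (r + 1) = (r + 2 + l + r) + 1 by omega, Nat.factorial_succ]
    push_cast at ih ⊢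
    rw [← ih, abs_of_nonneg]
    · ring
    · nlinarith [(Nat.cast_nonneg r : (0:ℝ) ≤ r), (Nat.cast_nonneg l : (0:ℝ) ≤ l)]

lemma prod_all (k s : ℕ) (hk : 1 ≤ k) (h : k ≤ s) :
    2 * (k:ℝ)^2 * (∏ j ∈ (Icc 1 s).erase k, |(k:ℝ)^2 - (j:ℝ)^2|)
      = (s - k).factorial * (s + k).factorial := by
  induction s, h using Nat.le_induction with
  | base =>
    obtain ⟨l, rfl⟩ := Nat.exists_eq_succ_of_ne_zero (by omega : k ≠ 0)
    have := prod_low (l+1) l (by omega)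
    have e : (Icc 1 (l+1)).erase (l+1) = Icc 1 l := by
      ext i; simp only [mem_erase, mem_Icc]; omega
    simp only [Nat.succ_eq_add_one]
    rw [e, Nat.sub_self, show l + 1 + (l + 1) = (l + 1 + l) + 1 by omega,
      Nat.factorial_succ (l+1+l)]
    simp only [Nat.add_sub_cancel_left, Nat.sub_self, Nat.factorial_zero] at this
    push_cast at this ⊢
    rw [← this]; ring
  | succ s hs ih =>
    have e : (Icc 1 (s+1)).erase k = insert (s+1) ((Icc 1 s).erase k) := by
      ext i; simp only [mem_erase, mem_Icc, mem_insert]; omega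
    rw [e, prod_insert (by simp)]
    obtain ⟨l, rfl⟩ := Nat.exists_eq_add_of_le hs
    rw [show k + l + 1 - k = l + 1 by omega, Nat.factorial_succ,
      show k + l + 1 + k = (k + l + k) + 1 by omega, Nat.factorial_succ (k+l+k)]
    rw [Nat.add_sub_cancel_left] at ih
    have : |(k:ℝ)^2 - ((k + l + 1 : ℕ):ℝ)^2| = (l + 1) * (k + l + k + 1) := by
      rw [abs_of_nonpos]
      · push_cast; ring
      · push_cast
        nlinarith [(Nat.cast_nonneg k : (0:ℝ) ≤ k), (Nat.cast_nonneg l : (0:ℝ) ≤ l)]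
    rw [this]
    push_cast
    linear_combination ((l:ℝ) + 1) * (k + l + k + 1) * ih

lemma fact_le (s k : ℕ) (h : k ≤ s) :
    s.factorial * s.factorial ≤ (s - k).factorial * (s + k).factorial := by
  have h1 := Nat.choose_le_centralBinom (s + k) s
  have h2 := Nat.choose_mul_factorial_mul_factorial (by omega : s + k ≤ 2 * s)
  have h3 := Nat.choose_mul_factorial_mul_factorial (by omega : s ≤ 2 * s)
  rw [Nat.centralBinom] at h1
  rw [show 2 * s - (s + k) = s - k by omega] at h2
  rw [show 2 * s - s = s by omega] at h3
  have hp : 0 < (2*s).choose s := Nat.choose_pos (by omega)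
  by_contra hc
  push Not at hc
  have : (2*s).choose (s+k) * ((s - k).factorial * (s + k).factorial)
      < (2*s).choose s * (s.factorial * s.factorial) :=
    lt_of_le_of_lt (Nat.mul_le_mul_right _ h1) (Nat.mul_lt_mul_of_pos_left hc hp)
  have e1 : (2*s).choose (s+k) * ((s - k).factorial * (s + k).factorial) = (2*s).factorial := by
    rw [← h2]; ring
  have e2 : (2*s).choose s * (s.factorial * s.factorial) = (2*s).factorial := by
    rw [← h3]; ring
  omega

lemma prod_sq (s : ℕ) : ∏ j ∈ Icc 1 s, ((j:ℝ)^2) = (s.factorial : ℝ)^2 := by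
  induction s with
  | zero => simp
  | succ s ih =>
    rw [prod_Icc_succ_top (by omega), ih, Nat.factorial_succ]; push_cast; ring

lemma ratio_le (k s : ℕ) (hk : 1 ≤ k) (h : k ≤ s) :
    ∏ j ∈ Icc 1 s, ((j:ℝ)^2) ≤
      2 * (k:ℝ)^2 * (∏ j ∈ (Icc 1 s).erase k, |(k:ℝ)^2 - (j:ℝ)^2|) := by
  rw [prod_sq, prod_all k s hk h, sq]
  exact_mod_cast fact_le s k h

lemma sum_bound (s : ℕ) :
    ∑ k ∈ Icc 1 s, 2 / (25 * (k:ℝ)^2 - 1) ≤ 1/4 - 1 / (4 * ((s:ℝ) + 1)) := by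
  induction s with
  | zero => norm_num
  | succ s ih =>
    rw [sum_Icc_succ_top (by omega)]
    push_cast
    have hs : (0:ℝ) ≤ s := Nat.cast_nonneg s
    have : 2 / (25 * ((s:ℝ)+1)^2 - 1) ≤ 1 / (4 * ((s:ℝ) + 1)) - 1 / (4 * ((s:ℝ) + 1 + 1)) := by
      rw [div_sub_div _ _ (by positivity) (by positivity), div_le_div_iff₀ (by nlinarith) (by positivity)]
      nlinarith [mul_nonneg hs hs]
    linarith

def nodes (s : ℕ) : Finset ℕ := insert 0 (insert 1 ((Icc 1 s).image (fun k => 25 * k^2)))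

lemma img_inj (s : ℕ) (A : Finset ℕ) : Set.InjOn (fun k : ℕ => 25 * k^2) A := by
  intro a _ b _ h
  have : a^2 = b^2 := by simpa using h
  exact Nat.pow_left_injective (by norm_num : (2:ℕ) ≠ 0) this

lemma zero_notMem (A : Finset ℕ) (hA : ∀ k ∈ A, 1 ≤ k) :
    0 ∉ insert 1 (A.image (fun k => 25 * k^2)) := by
  simp only [mem_insert, mem_image, not_or, not_exists, not_and]
  refine ⟨by norm_num, fun k hk h => ?_⟩
  have := hA k hk
  have : 0 < 25 * k^2 := by positivity
  omega

lemma one_notMem (A : Finset ℕ) : 1 ∉ (A.image (fun k => 25 * k^2)) := by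
  simp only [mem_image, not_exists, not_and]
  intro k hk h
  omega

def wt (s n : ℕ) : ℝ := ∏ j ∈ (nodes s).erase n, ((n:ℝ) - j)

lemma wt_zero (s : ℕ) : wt s 0 = - ∏ k ∈ Icc 1 s, (-(25 * (k:ℝ)^2)) := by
  unfold wt nodes
  rw [erase_insert (zero_notMem _ (fun k hk => (mem_Icc.1 hk).1)), prod_insert (one_notMem _),
    prod_image (img_inj s _)]
  push_cast
  simp

lemma wt_one (s : ℕ) : wt s 1 = ∏ k ∈ Icc 1 s, (1 - (25 * (k:ℝ)^2)) := by
  unfold wt nodes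
  rw [insert_comm, erase_insert, prod_insert, prod_image (img_inj s _)]
  · push_cast
    simp
  · intro h
    exact zero_notMem (Icc 1 s) (fun k hk => (mem_Icc.1 hk).1) (mem_insert_of_mem h)
  · intro h
    rcases mem_insert.1 h with h | h
    · omega
    · exact one_notMem _ h

lemma wt_img (s k : ℕ) (hk : 1 ≤ k) (h : k ≤ s) : |wt s (25 * k^2)| =
    (25 * (k:ℝ)^2) * (25 * (k:ℝ)^2 - 1) *
      ∏ j ∈ (Icc 1 s).erase k, (25 * |(k:ℝ)^2 - (j:ℝ)^2|) := by
  have e : (nodes s).erase (25 * k^2) =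
      insert 0 (insert 1 (((Icc 1 s).erase k).image (fun k => 25 * k^2))) := by
    have hk2 : 1 ≤ k^2 := Nat.one_le_pow _ _ hk
    ext i
    simp only [nodes, mem_erase, mem_insert, mem_image]
    constructor
    · rintro ⟨h1, h2 | h2 | ⟨j, hj, rfl⟩⟩
      · simp [h2]
      · simp [h2]
      · exact Or.inr (Or.inr ⟨j, ⟨fun h => h1 (by rw [h]), hj⟩, rfl⟩)
    · rintro (h2 | h2 | ⟨j, ⟨hj1, hj⟩, rfl⟩)
      · exact ⟨by omega, by simp [h2]⟩
      · exact ⟨by omega, by simp [h2]⟩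
      · exact ⟨fun h => hj1 (Nat.pow_left_injective (by norm_num : (2:ℕ) ≠ 0) (by simpa using h)), Or.inr (Or.inr ⟨j, hj, rfl⟩)⟩
  have hk1 : (1:ℝ) ≤ k := by exact_mod_cast hk
  unfold wt
  rw [e, prod_insert (zero_notMem _ (fun k hk => (mem_Icc.1 (mem_of_mem_erase hk)).1)),
    prod_insert (one_notMem _), prod_image (img_inj s _), abs_mul, abs_mul, abs_prod, ← mul_assoc]
  push_cast
  congr 1
  · rw [sub_zero, abs_of_nonneg (by positivity), abs_of_nonneg (by nlinarith)]
  · apply prod_congr rfl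
    intro j _
    rw [← mul_sub, abs_mul]; norm_num

lemma img_ratio (s k : ℕ) (hk : 1 ≤ k) (h : k ≤ s) :
    |wt s 0 / wt s (25 * k^2)| ≤ 2 / (25 * (k:ℝ)^2 - 1) := by
  have hk1 : (1:ℝ) ≤ k := by exact_mod_cast hk
  have hpos : 0 < ∏ j ∈ (Icc 1 s).erase k, |(k:ℝ)^2 - (j:ℝ)^2| := by
    apply prod_pos
    intro j hj
    rw [abs_pos, sub_ne_zero]
    intro h
    have h' : k^2 = j^2 := by exact_mod_cast h
    exact (mem_erase.1 hj).1 (Nat.pow_left_injective (by norm_num : (2:ℕ) ≠ 0) h').symm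
  have hr := ratio_le k s hk h
  have hc : #(Icc 1 s) = #((Icc 1 s).erase k) + 1 := by
    rw [card_erase_of_mem (mem_Icc.2 ⟨hk, h⟩)]; simp; omega
  have h0 : |wt s 0| = 25 ^ (#((Icc 1 s).erase k) + 1) * ∏ j ∈ Icc 1 s, ((j:ℝ)^2) := by
    rw [wt_zero, abs_neg, abs_prod, ← hc, ← prod_const, ← prod_mul_distrib]
    apply prod_congr rfl
    intro j _
    rw [abs_neg, abs_of_nonneg (by positivity)]
  rw [abs_div, wt_img s k hk h, h0, prod_mul_distrib, prod_const]
  have hd : 0 < 25 * (k:ℝ)^2 - 1 := by nlinarith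
  set c := #((Icc 1 s).erase k)
  set P := ∏ j ∈ (Icc 1 s).erase k, |(k:ℝ)^2 - (j:ℝ)^2|
  set R := ∏ j ∈ Icc 1 s, ((j:ℝ)^2)
  rw [div_le_div_iff₀ (by positivity) hd]
  have : (0:ℝ) ≤ 25^(c+1) * (25 * (k:ℝ)^2 - 1) := by positivity
  have := mul_le_mul_of_nonneg_left hr this
  calc _ = 25^(c+1) * (25 * (k:ℝ)^2 - 1) * R := by ring
    _ ≤ _ := this
    _ = _ := by ring

lemma exists_psi (s m : ℕ) (hm : 1 ≤ m) (hs : 25 * s^2 ≤ m) : ∃ ψ : ℕ → ℝ, ψ 0 = -1 ∧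
    (∀ r : Polynomial ℝ, r.natDegree ≤ s → ∑ k ∈ range (m+1), ψ k * r.eval (k:ℝ) = 0) ∧
    ∑ k ∈ range (m+1), (if k = 0 then 0 else max (-ψ k) 0) ≤ 1/4 := by
  have hw0 : wt s 0 ≠ 0 := by
    rw [wt_zero, neg_ne_zero, prod_ne_zero_iff]
    intro k hk
    have : (1:ℝ) ≤ k := by exact_mod_cast (mem_Icc.1 hk).1
    have : 0 < 25 * (k:ℝ)^2 := by positivity
    linarith
  have hsub : nodes s ⊆ range (m+1) := by
    intro n hn
    simp only [nodes, mem_insert, mem_image, mem_Icc] at hn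
    rw [mem_range]
    rcases hn with h | h | ⟨k, hk, rfl⟩
    · omega
    · omega
    · have : k^2 ≤ s^2 := Nat.pow_le_pow_left hk.2 2
      omega
  have h0 : 0 ∈ nodes s := by simp [nodes]
  have hcard : #(nodes s) = s + 2 := by
    unfold nodes
    rw [card_insert_of_notMem (zero_notMem _ (fun k hk => (mem_Icc.1 hk).1)),
      card_insert_of_notMem (one_notMem _), card_image_of_injOn (img_inj s _)]
    simp
  refine ⟨fun n => if n ∈ nodes s then - (wt s 0 / wt s n) else 0, ?_, ?_, ?_⟩
  · simp [h0, hw0]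
  · intro r hr
    rw [← sum_subset hsub]
    · have hdeg : r.degree < #(nodes s) := by
        refine lt_of_le_of_lt Polynomial.degree_le_natDegree ?_
        rw [hcard]; exact_mod_cast (by omega : r.natDegree < s + 2)
      have h := Lagrange.coeff_eq_sum (s := nodes s) (v := fun n : ℕ => (n:ℝ))
        (Nat.cast_injective.injOn) hdeg
      rw [hcard, Polynomial.coeff_eq_zero_of_natDegree_lt (by omega)] at h
      calc _ = - wt s 0 * ∑ i ∈ nodes s, r.eval (i:ℝ) / ∏ j ∈ (nodes s).erase i, ((i:ℝ) - j) := by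
            rw [mul_sum]
            apply sum_congr rfl
            intro i hi
            simp only [if_pos hi]
            rw [wt.eq_1 s i]; ring
        _ = 0 := by rw [← h, mul_zero]
    · intro n _ hn
      simp [hn]
  · have hz : ∀ n ∈ range (m+1), n ∉ (Icc 1 s).image (fun k => 25 * k^2) →
      (if n = 0 then 0 else max (-(if n ∈ nodes s then - (wt s 0 / wt s n) else 0)) 0) = 0 := by
      intro n _ hn
      by_cases hn0 : n = 0
      · simp [hn0]
      rw [if_neg hn0]
      by_cases hn1 : n = 1
      · subst hn1
        rw [if_pos (by simp [nodes]), neg_neg]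
        apply max_eq_right
        rw [wt_zero, wt_one, neg_div, neg_nonpos, ← prod_div_distrib]
        apply prod_nonneg
        intro k hk
        have : (1:ℝ) ≤ k := by exact_mod_cast (mem_Icc.1 hk).1
        apply div_nonneg_of_nonpos <;> nlinarith
      · rw [if_neg]
        · simp
        · intro h
          rcases mem_insert.1 h with h | h
          · exact hn0 h
          · rcases mem_insert.1 h with h | h
            · exact hn1 h
            · exact hn h
    rw [← sum_subset (s₁ := (Icc 1 s).image (fun k => 25 * k^2)) _ hz, sum_image (img_inj s _)]
    · refine le_trans (sum_le_sum (g := fun k : ℕ => 2 / (25 * (k:ℝ)^2 - 1)) ?_)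
        ((sum_bound s).trans ?_)
      · intro k hk
        obtain ⟨hk1, hks⟩ := mem_Icc.1 hk
        have : 1 ≤ k^2 := Nat.one_le_pow _ _ hk1
        rw [if_neg (by omega), if_pos (by
          simp only [nodes, mem_insert]
          exact Or.inr (Or.inr (mem_image_of_mem _ hk))), neg_neg]
        have hb := img_ratio s k hk1 hks
        exact max_le ((le_abs_self _).trans hb) ((abs_nonneg _).trans hb)
      · have : (0:ℝ) ≤ 1 / (4 * ((s:ℝ) + 1)) := by positivity
        linarith
    · intro n hn
      exact hsub (mem_insert_of_mem (mem_insert_of_mem hn))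

lemma exists_dual (s m : ℕ) (hm : 1 ≤ m) (hs : 25 * s^2 ≤ m) :
    ∃ Psi mu nu : (Fin m → Bool) → ℝ,
    (∀ y, 0 ≤ mu y) ∧ (∀ y, 0 ≤ nu y) ∧ nu (fun _ => true) = 0 ∧ mu (fun _ => true) = 0 ∧
    Psi (fun _ => true) ≤ 0 ∧ (∀ y, y ≠ (fun _ => true) → Psi y = nu y - mu y) ∧
    ∑ y, mu y ≤ 1/4 ∧ 1 ≤ ∑ y, nu y ∧
    ∀ S : Finset (Fin m), #S ≤ s → ∑ y, Psi y * chi S y = 0 := by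
  obtain ⟨ψ, h0, hψ, hb⟩ := exists_psi s m hm hs
  set g : ℕ → ℝ := fun k => if k = 0 then 0 else max (-ψ k) 0 with hg
  set g' : ℕ → ℝ := fun k => if k = 0 then 0 else max (ψ k) 0 with hg'
  have hft : #(fal (fun _ : Fin m => true)) = 0 := by simp [fal]
  have hf0 : ∀ y : Fin m → Bool, y ≠ (fun _ => true) → #(fal y) ≠ 0 := by
    intro y hy h
    apply hy
    apply (fal_bij m).1
    rw [card_eq_zero.1 h, card_eq_zero.1 hft]
  have hgn : ∀ k, 0 ≤ g k := by
    intro k; simp only [hg]; split_ifs <;> simp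
  have hgn' : ∀ k, 0 ≤ g' k := by
    intro k; simp only [hg']; split_ifs <;> simp
  have hgg : ∀ k, k ≠ 0 → ψ k = g' k - g k := by
    intro k hk
    simp only [hg, hg', if_neg hk]
    rcases le_total 0 (ψ k) with h | h
    · rw [max_eq_left h, max_eq_right (by linarith)]; ring
    · rw [max_eq_right h, max_eq_left (by linarith)]; ring
  refine ⟨fun y => ψ #(fal y) / m.choose #(fal y), fun y => g #(fal y) / m.choose #(fal y),
    fun y => g' #(fal y) / m.choose #(fal y), fun y => div_nonneg (hgn _) (Nat.cast_nonneg _),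
    fun y => div_nonneg (hgn' _) (Nat.cast_nonneg _), ?_, ?_, ?_, ?_, ?_, ?_, ?_⟩
  · simp [hft, hg']
  · simp [hft, hg]
  · simp [hft, h0]
  · intro y hy
    simp only
    rw [hgg _ (hf0 y hy)]; ring
  · rw [sum_fal_card]; exact hb
  · rw [sum_fal_card]
    have h1 := hψ 1 (by simp)
    have hs0 : 0 ≤ ∑ k ∈ range (m+1), g k := sum_nonneg fun k _ => hgn k
    have h2 : ∀ k, ψ k = g' k - g k + (if k = 0 then -1 else 0) := by
      intro k
      by_cases hk : k = 0
      · subst hk; simp [hg, hg', h0]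
      · rw [hgg k hk]; simp [hk]
    simp only [Polynomial.eval_one, mul_one] at h1
    rw [sum_congr rfl (fun k _ => h2 k), sum_add_distrib, sum_sub_distrib] at h1
    simp at h1
    linarith
  · intro S hS
    exact sum_chi m s ψ hψ S hS

lemma chi_split {t m : ℕ} (S : Finset (Fin t × Fin m)) (i : Fin t) (x : Fin t → Fin m → Bool)
    (y : Fin m → Bool) :
    chi S (fun e => Function.update x i y e.1 e.2) =
      chi ((S.filter (fun e => e.1 = i)).image Prod.snd) y *
        ∏ e ∈ S.filter (fun e => ¬ e.1 = i), bval (x e.1 e.2) := by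
  unfold chi
  rw [← prod_filter_mul_prod_filter_not S (fun e => e.1 = i)]
  congr 1
  · rw [prod_image]
    · apply prod_congr rfl
      intro e he
      have := (mem_filter.1 he).2
      rw [← this]; simp
    · intro a ha b hb h
      have h1 := (mem_filter.1 ha).2
      have h2 := (mem_filter.1 hb).2
      exact Prod.ext (h1.trans h2.symm) h
  · apply prod_congr rfl
    intro e he
    have := (mem_filter.1 he).2
    simp only [Function.update_of_ne this]

/-- there is a constant `c > 0` such that for all `d, t ≥ 1`, the
read-once DNF `F = OR_t(AND_{d²}, …, AND_{d²})` on `n = t·d²` variables satisfies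
`deg̃_{1-2^{-t}}(F) ≥ c·d`: every real polynomial of degree less than `c·d` differs from
`F` by more than `1 - 2^{-t}` at some input. -/
theorem read_once_dnf_approx_degree :
    ∃ c : ℝ, 0 < c ∧ ∀ d t : ℕ, 1 ≤ d → 1 ≤ t →
      ∀ p : Finset (Fin t × Fin (d ^ 2)) → ℝ, ∀ D : ℕ, degLE p D → (D : ℝ) < c * d →
        ∃ x : Fin t × Fin (d ^ 2) → Bool,
          1 - (1/2) ^ t < |polyOf p x - bval (orBlock t (ANDf (d ^ 2)) x)| := by
  refine ⟨1/5, by norm_num, ?_⟩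
  intro d t hd ht p D hp hD
  by_contra hcon
  push Not at hcon
  have hDs : D ≤ d / 5 := by
    rw [Nat.le_div_iff_mul_le (by norm_num)]
    have : (D:ℝ) * 5 ≤ d := by linarith
    exact_mod_cast this
  have hm : 1 ≤ d^2 := Nat.one_le_pow _ _ hd
  have hs : 25 * (d/5)^2 ≤ d^2 := by
    have : 5 * (d/5) ≤ d := Nat.mul_div_le d 5
    calc 25 * (d/5)^2 = (5 * (d/5))^2 := by ring
      _ ≤ d^2 := Nat.pow_le_pow_left this 2
  obtain ⟨Psi, mu, nu, h1, h2, h3, h4, h5, h6, h7, h8, h9⟩ := exists_dual (d/5) (d^2) hm hs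
  have h2t : (0:ℝ) < 2^t := by positivity
  have hinv : (2:ℝ)^t * (1/2)^t = 1 := by rw [← mul_pow]; norm_num
  have hand : ∀ z : Fin (d^2) → Bool, ANDf (d^2) z = true ↔ z = fun _ => true := by
    intro z
    simp [ANDf, funext_iff]
  have hU1 : (1:ℝ) ≤ 2^t := one_le_pow₀ (by norm_num)
  have key := amplify (fun _ => true) Psi mu nu h1 h2 h3 h4 h5 h6 h7 h8 t (2 * 2^t - 1)
    (fun x => 2^t * polyOf p (fun e => x e.1 e.2)) (by linarith) ?_ ?_ ?_ ?_
  · have h4t : (2:ℝ)^t * 2^t * (1/4)^t = 1 := by rw [← mul_pow, ← mul_pow]; norm_num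
    have hq : (0:ℝ) < (1/4)^t := by positivity
    have ht2 : (2:ℝ) ≤ 2^t := by
      calc (2:ℝ) = 2^1 := by norm_num
        _ ≤ 2^t := pow_le_pow_right₀ (by norm_num) ht
    have : (2 * 2^t - 1) * (1/4:ℝ)^t < 2^t * 2^t * (1/4)^t := by
      apply mul_lt_mul_of_pos_right _ hq
      nlinarith
    linarith
  · intro i x
    simp only [polyOf, mul_sum]
    rw [sum_comm]
    apply sum_eq_zero
    intro S _
    by_cases hS : D < #S
    · simp [hp S hS]
    · have hc : #((S.filter (fun e => e.1 = i)).image Prod.snd) ≤ d/5 :=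
        (card_image_le.trans (card_filter_le _ _)).trans (by omega)
      have h := h9 _ hc
      simp only [chi_split]
      calc _ = 2^t * p S * (∏ e ∈ S.filter (fun e => ¬ e.1 = i), bval (x e.1 e.2)) *
            ∑ y, Psi y * chi ((S.filter (fun e => e.1 = i)).image Prod.snd) y := by
            rw [mul_sum]; apply sum_congr rfl; intros; ring
        _ = 0 := by rw [h, mul_zero]
  · intro x hx
    have h := hcon (fun e => x e.1 e.2)
    have hF : orBlock t (ANDf (d^2)) (fun e => x e.1 e.2) = false := by
      simp only [orBlock, hand, decide_eq_false_iff_not, not_exists]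
      exact hx
    rw [hF, abs_le] at h
    simp only [bval] at h
    have := h.1
    have h' : (1/2:ℝ)^t ≤ polyOf p (fun e => x e.1 e.2) := by simp at this ⊢; linarith
    have := mul_le_mul_of_nonneg_left h' h2t.le
    linarith
  · intro x hx
    have h := hcon (fun e => x e.1 e.2)
    have hF : orBlock t (ANDf (d^2)) (fun e => x e.1 e.2) = true := by
      simp only [orBlock, hand, decide_eq_true_eq]
      exact hx
    rw [hF, abs_le] at h
    simp only [bval] at h
    have := h.2
    have hp2 : (0:ℝ) < (1/2)^t := by positivity
    have h' : polyOf p (fun e => x e.1 e.2) ≤ 0 := by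
      rw [if_pos trivial] at this; linarith
    exact mul_nonpos_of_nonneg_of_nonpos h2t.le h'
  · intro x
    have h := (abs_le.1 (hcon (fun e => x e.1 e.2))).2
    have hb : bval (orBlock t (ANDf (d^2)) (fun e => x e.1 e.2)) ≤ 1 := by
      unfold bval; split_ifs <;> norm_num
    have h' : polyOf p (fun e => x e.1 e.2) ≤ 2 - (1/2)^t := by linarith
    have := mul_le_mul_of_nonneg_left h' h2t.le
    linarith

end
end

section
/- Let t ≥ 1 be an integer, let f : {-1,1}^m → {-1,1} be a Boolean function, and let p be a real polynomial on {-1,1}^m of degree at most d and weight at most w satisfying |p(x) − f(x)| < 1/t for all x ∈ {-1,1}^m. Define q : ({-1,1}^m)^t → ℝ by q(x_1,…,x_t) = 1 − t + ∑_{i=1}^t p(x_i). Then q has degree at most d, weight at most t·w + t + 1, and sign-represents the block composition F = OR_t(f,…,f): F(x_1,…,x_t)·q(x_1,…,x_t) > 0 for all (x_1,…,x_t) ∈ ({-1,1}^m)^t. -/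
open Finset

noncomputable section

/-- The weight of a polynomial: the `ℓ₁`-norm of its coefficients. -/
def weight {ι : Type*} [Fintype ι] (c : Finset ι → ℝ) : ℝ := ∑ S : Finset ι, |c S|

/-- if `p` has degree at most `d`, weight at most `w`, and approximates
`f` pointwise with error less than `1/t`, then `q(x_1,…,x_t) = 1 - t + ∑_i p(x_i)` is a
polynomial of degree at most `d` and weight at most `t·w + t + 1` that sign-represents
`OR_t(f, …, f)`. -/
theorem dnf_ptf_from_approx (m d t : ℕ) (ht : 1 ≤ t)
    (f : (Fin m → Bool) → Bool) (c : Finset (Fin m) → ℝ) (w : ℝ)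
    (hdeg : degLE c d) (hw : weight c ≤ w)
    (happ : ∀ x : Fin m → Bool, |polyOf c x - bval (f x)| < 1 / t) :
    (∃ cq : Finset (Fin t × Fin m) → ℝ, degLE cq d ∧
      weight cq ≤ t * w + t + 1 ∧
      ∀ x : Fin t × Fin m → Bool,
        polyOf cq x = 1 - t + ∑ i : Fin t, polyOf c (fun j => x (i, j))) ∧
    (∀ x : Fin t × Fin m → Bool,
      0 < bval (orBlock t f x) * (1 - t + ∑ i : Fin t, polyOf c (fun j => x (i, j)))) := by
  have ht' : (0 : ℝ) < t := by exact_mod_cast ht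
  have ht1 : (1 : ℝ) ≤ t := by exact_mod_cast ht
  haveI : Nonempty (Fin t) := ⟨⟨0, ht⟩⟩
  constructor
  · let e : Fin t → (Fin m ↪ Fin t × Fin m) := fun i =>
      ⟨fun j => (i, j), fun a b h => (Prod.mk.inj h).2⟩
    refine ⟨fun S => (if S = ∅ then (1 - t : ℝ) else 0) +
      ∑ i : Fin t, ∑ T : Finset (Fin m), if T.map (e i) = S then c T else 0, ?_, ?_, ?_⟩
    · intro S hS
      have hne : S ≠ ∅ := by
        rintro rfl
        simp at hS
      simp only [if_neg hne, zero_add]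
      refine Finset.sum_eq_zero fun i _ => Finset.sum_eq_zero fun T _ => ?_
      split_ifs with h
      · apply hdeg
        rw [← h, Finset.card_map] at hS
        exact hS
      · rfl
    · have h1 : weight (fun S : Finset (Fin t × Fin m) => (if S = ∅ then (1 - t : ℝ) else 0) +
          ∑ i : Fin t, ∑ T : Finset (Fin m), if T.map (e i) = S then c T else 0) ≤
          ∑ S : Finset (Fin t × Fin m), ((if S = ∅ then |(1 - t : ℝ)| else 0) +
          ∑ i : Fin t, ∑ T : Finset (Fin m), if T.map (e i) = S then |c T| else 0) := by
        refine Finset.sum_le_sum fun S _ => (abs_add_le _ _).trans (add_le_add ?_ ?_)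
        · split_ifs <;> simp
        · refine (Finset.abs_sum_le_sum_abs _ _).trans (Finset.sum_le_sum fun i _ => ?_)
          refine (Finset.abs_sum_le_sum_abs _ _).trans (Finset.sum_le_sum fun T _ => ?_)
          split_ifs <;> simp
      refine h1.trans ?_
      rw [Finset.sum_add_distrib, Finset.sum_comm]
      have h2 : ∀ i : Fin t, ∑ S : Finset (Fin t × Fin m), ∑ T : Finset (Fin m),
          (if T.map (e i) = S then |c T| else 0) = weight c := by
        intro i
        rw [Finset.sum_comm]
        simp [weight]
      rw [Finset.sum_congr rfl fun i _ => h2 i]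
      have h3 : |(1 - t : ℝ)| = t - 1 := by
        rw [abs_of_nonpos (by linarith)]
        ring
      simp only [Finset.sum_ite_eq', Finset.mem_univ, if_true, Finset.sum_const,
        Finset.card_univ, Fintype.card_fin, nsmul_eq_mul, h3]
      nlinarith [mul_le_mul_of_nonneg_left hw ht'.le]
    · intro x
      simp only [polyOf, add_mul, Finset.sum_add_distrib, Finset.sum_mul]
      congr 1
      · simp [ite_mul, chi]
      · rw [Finset.sum_comm]
        refine Finset.sum_congr rfl fun i _ => ?_
        rw [Finset.sum_comm]
        refine Finset.sum_congr rfl fun T _ => ?_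
        simp [ite_mul, chi, e]
        exact Or.inl rfl
  · intro x
    have hc : ∑ _i : Fin t, (1 / t : ℝ) = 1 := by
      simp [ht'.ne']
    by_cases h : ∃ i : Fin t, f (fun j => x (i, j)) = true
    · have hb : bval (orBlock t f x) = -1 := by
        simp [orBlock, bval, h]
      obtain ⟨i, hi⟩ := h
      have hlt : ∑ k : Fin t, polyOf c (fun j => x (k, j)) <
          ∑ k : Fin t, ((1 / t : ℝ) + (1 - if k = i then 2 else 0)) := by
        refine Finset.sum_lt_sum_of_nonempty Finset.univ_nonempty fun k _ => ?_
        have hk := (abs_lt.mp (happ (fun j => x (k, j)))).2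
        have hle : bval (f (fun j => x (k, j))) ≤ 1 - if k = i then 2 else 0 := by
          by_cases hki : k = i
          · subst hki
            simp only [hi, bval, if_true]
            norm_num
          · simp only [if_neg hki, bval]
            split_ifs <;> norm_num
        linarith
      rw [Finset.sum_add_distrib, hc, Finset.sum_sub_distrib] at hlt
      simp at hlt
      rw [hb]
      linarith
    · have hb : bval (orBlock t f x) = 1 := by
        simp only [orBlock, bval, h]
        simp
      have hlt : ∑ k : Fin t, ((1 : ℝ) - 1 / t) < ∑ k : Fin t, polyOf c (fun j => x (k, j)) := by
        refine Finset.sum_lt_sum_of_nonempty Finset.univ_nonempty fun k _ => ?_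
        have hk := (abs_lt.mp (happ (fun j => x (k, j)))).1
        have hf : f (fun j => x (k, j)) = false := by
          by_contra hh
          exact h ⟨k, by simpa using hh⟩
        rw [hf] at hk
        simp only [bval] at hk
        norm_num at hk ⊢
        linarith
      rw [Finset.sum_sub_distrib, hc] at hlt
      simp at hlt
      rw [hb]
      linarith

end
end
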